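/- Fix integers n ≥ 1 and k ≥ 0 and a real number ν, and set μ = (2k+n)(2k+n+2) − n². Define λ(N) = μ/4 + (n+N)(n+N+1) + ∫₀^π δV(s) [y_{n+N,n}(s)]² ds for integers N ≥ 0. Then the quantity λ(N) − (1−ν²)·N(N + 2n + 1) remains bounded as N → ∞. -/

import Mathlib

open Set Real

/-- The Legendre polynomial `P_ℓ(x) = (1/(2^ℓ ℓ!)) (d/dx)^ℓ (x²−1)^ℓ`. -/
noncomputable def legendreP (l : ℕ) (x : ℝ) : ℝ :=
  (1 / ((2 : ℝ) ^ l * (Nat.factorial l : ℝ))) * iteratedDeriv l (fun t => (t ^ 2 - 1) ^ l) x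

/-- The associated Legendre function `P_ℓⁿ(x) = (1−x²)^{n/2} (d/dx)ⁿ P_ℓ(x)` for `0 ≤ n ≤ ℓ`. -/
noncomputable def assocLegendreP (l n : ℕ) (x : ℝ) : ℝ :=
  (1 - x ^ 2) ^ ((n : ℝ) / 2) * iteratedDeriv n (legendreP l) x

/-- The normalized eigenfunction
`y_{ℓ,n}(s) = √((1+2ℓ)(ℓ−n)!/(2(ℓ+n)!)) · √(sin s) · P_ℓⁿ(cos s)`. -/
noncomputable def pageY (l n : ℕ) (s : ℝ) : ℝ :=
  Real.sqrt ((1 + 2 * (l : ℝ)) * (Nat.factorial (l - n) : ℝ) / (2 * (Nat.factorial (l + n) : ℝ))) *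
    (Real.sqrt (Real.sin s) * assocLegendreP l n (Real.cos s))

/-- The first-order perturbation potential
`δV(s) = (ν² csc²(s)/32)·[5μ − 4(μ + 4n² + 1)cos(2s) + 32n² s cot(s) − 16n² − μ cos(4s)
− 8 s cot(s) + 12]`. -/
noncomputable def deltaV (n : ℕ) (ν μ : ℝ) (s : ℝ) : ℝ :=
  (ν ^ 2 * (1 / Real.sin s) ^ 2 / 32) *
    (5 * μ - 4 * (μ + 4 * (n : ℝ) ^ 2 + 1) * Real.cos (2 * s) +
      32 * (n : ℝ) ^ 2 * s * (Real.cos s / Real.sin s) - 16 * (n : ℝ) ^ 2 -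
      μ * Real.cos (4 * s) - 8 * s * (Real.cos s / Real.sin s) + 12)

open Polynomial in
/-- derivatives of (X^2-1)^l -/
noncomputable def rodD (l j : ℕ) : ℝ[X] := derivative^[j] ((X ^ 2 - 1) ^ l)

open Polynomial in
lemma rodD_succ (l j : ℕ) : derivative (rodD l j) = rodD l (j+1) := by
  unfold rodD; rw [Function.iterate_succ_apply']

open Polynomial in
lemma rodD_ode0 (l : ℕ) : (X ^ 2 - 1) * rodD l 1 = C (2 * (l:ℝ)) * X * rodD l 0 := by
  unfold rodD
  cases l with
  | zero => simp
  | succ l =>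
    simp [derivative_pow]
    simp only [map_ofNat]
    ring

open Polynomial in
lemma rodD_ode (l j : ℕ) : (X ^ 2 - 1) * rodD l (j+2) =
    C (2 * (l:ℝ) - 2 * (j+1)) * X * rodD l (j+1) + C (2 * (l:ℝ) * (j+1) - j*(j+1)) * rodD l j := by
  induction j with
  | zero =>
    have h := congrArg derivative (rodD_ode0 l)
    simp only [derivative_mul, rodD_succ, derivative_sub, derivative_C, derivative_X, derivative_X_pow, derivative_one] at h
    simp at h ⊢
    simp only [map_ofNat] at h ⊢
    linear_combination h
  | succ j ih =>
    have h := congrArg derivative ih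
    simp only [derivative_mul, derivative_add, rodD_succ, derivative_sub, derivative_C, derivative_X, derivative_X_pow, derivative_one] at h
    simp at h ⊢
    simp only [map_ofNat] at h ⊢
    linear_combination h

lemma iteratedDeriv_poly (p : Polynomial ℝ) (j : ℕ) :
    iteratedDeriv j (fun x => p.eval x) = fun x => (Polynomial.derivative^[j] p).eval x := by
  induction j with
  | zero => simp
  | succ j ih =>
    rw [iteratedDeriv_succ, ih, Function.iterate_succ_apply']
    ext x
    simp

/-- n-th derivative of the Legendre polynomial -/
noncomputable def legQ (l n : ℕ) (x : ℝ) : ℝ :=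
  (1 / ((2 : ℝ) ^ l * (Nat.factorial l : ℝ))) * (rodD l (l + n)).eval x

lemma legQ_hasDeriv (l n : ℕ) (x : ℝ) : HasDerivAt (legQ l n) (legQ l (n+1) x) x := by
  unfold legQ
  have := ((rodD l (l+n)).hasDerivAt x).const_mul (1 / ((2 : ℝ) ^ l * (Nat.factorial l : ℝ)))
  rwa [rodD_succ] at this

lemma legQ_ode (l n : ℕ) (x : ℝ) : (1 - x^2) * legQ l (n+2) x =
    2 * (n+1) * x * legQ l (n+1) x - (l - n) * (l + n + 1) * legQ l n x := by
  have h := congrArg (Polynomial.eval x) (rodD_ode l (l+n))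
  simp at h
  unfold legQ
  rw [show l + (n+2) = l+n+2 by ring, show l + (n+1) = l+n+1 by ring]
  linear_combination -(1 / ((2 : ℝ) ^ l * (Nat.factorial l : ℝ))) * h

lemma legQ_top (l : ℕ) (x : ℝ) : legQ l l x = (Nat.factorial (2*l)) / (2^l * Nat.factorial l) := by
  have hmon : ((Polynomial.X ^ 2 - 1 : Polynomial ℝ) ^ l).Monic := by
    apply Polynomial.Monic.pow
    simpa using Polynomial.monic_X_pow_sub_C (1:ℝ) (n := 2) (by norm_num)
  have hdeg : ((Polynomial.X ^ 2 - 1 : Polynomial ℝ) ^ l).natDegree = 2 * l := by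
    rw [Polynomial.natDegree_pow]
    have : (Polynomial.X ^ 2 - 1 : Polynomial ℝ).natDegree = 2 := by
      simpa using Polynomial.natDegree_X_pow_sub_C (n := 2) (r := (1:ℝ))
    rw [this]; ring
  have h0 : (rodD l (l+l)).natDegree ≤ 0 := by
    have := Polynomial.natDegree_iterate_derivative ((Polynomial.X ^ 2 - 1 : Polynomial ℝ) ^ l) (l+l)
    rw [hdeg] at this
    unfold rodD
    omega
  unfold legQ
  rw [Polynomial.eq_C_of_natDegree_le_zero h0, rodD, Polynomial.coeff_iterate_derivative]
  have hc : ((Polynomial.X ^ 2 - 1 : Polynomial ℝ) ^ l).coeff (2*l) = 1 := by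
    rw [← hdeg]; exact hmon
  rw [show 0 + (l+l) = 2*l by ring, hc, show l + l = 2*l by ring, Nat.descFactorial_self]
  simp; ring

lemma legendreP_eq (l : ℕ) : legendreP l = legQ l 0 := by
  ext x
  unfold legendreP legQ
  have := iteratedDeriv_poly ((Polynomial.X ^ 2 - 1 : Polynomial ℝ) ^ l) l
  simp at this
  rw [this]; rfl

lemma iteratedDeriv_legendreP (l n : ℕ) : iteratedDeriv n (legendreP l) = legQ l n := by
  rw [legendreP_eq]
  induction n with
  | zero => simp
  | succ n ih =>
    rw [iteratedDeriv_succ, ih]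
    ext x
    exact (legQ_hasDeriv l n x).deriv

lemma legQc_hasDeriv (l n : ℕ) (s : ℝ) :
    HasDerivAt (fun s => legQ l n (cos s)) (-(sin s * legQ l (n+1) (cos s))) s := by
  have := (legQ_hasDeriv l n (cos s)).comp s (hasDerivAt_cos s)
  convert! this using 1
  ring

lemma legQc_cont (l n : ℕ) : Continuous (fun s => legQ l n (cos s)) :=
  continuous_iff_continuousAt.2 fun s => (legQc_hasDeriv l n s).continuousAt

/-- unnormalised norm -/
noncomputable def legI (l n : ℕ) : ℝ := ∫ s in (0:ℝ)..π, sin s ^ (2*n+1) * legQ l n (cos s) ^ 2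

lemma legI_succ (l n : ℕ) : legI l (n+1) = (l - n) * (l + n + 1) * legI l n := by
  have hc0 := legQc_cont l n
  have hc1 := legQc_cont l (n+1)
  have key : ∫ s in (0:ℝ)..π, ((l - n) * (l + n + 1) * (sin s ^ (2*n+1) * legQ l n (cos s) ^ 2)
      - sin s ^ (2*(n+1)+1) * legQ l (n+1) (cos s) ^ 2) = 0 := by
    rw [intervalIntegral.integral_eq_sub_of_hasDerivAt
      (f := fun s => sin s ^ (2*n+2) * (legQ l (n+1) (cos s) * legQ l n (cos s)))]
    · simp
    · intro s _
      have h := ((hasDerivAt_sin s).pow (2*n+2)).mul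
        ((legQc_hasDeriv l (n+1) s).mul (legQc_hasDeriv l n s))
      convert! h using 1
      have ho := legQ_ode l n (cos s)
      rw [← Real.sin_sq] at ho
      simp
      rw [show n+1+1 = n+2 by ring]
      linear_combination (sin s ^ (2*n+1) * legQ l n (cos s)) * ho
    · apply Continuous.intervalIntegrable; fun_prop
  rw [intervalIntegral.integral_sub (by apply Continuous.intervalIntegrable; fun_prop)
    (by apply Continuous.intervalIntegrable; fun_prop), intervalIntegral.integral_const_mul] at key
  unfold legI
  linarith

lemma prod_wallis (l : ℕ) : ∏ i ∈ Finset.range l, (2 * (i : ℝ) + 2) / (2 * i + 3) =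
    (2^l * Nat.factorial l)^2 / ((2*l+1) * Nat.factorial (2*l)) := by
  induction l with
  | zero => simp
  | succ l ih =>
    rw [Finset.prod_range_succ, ih, show 2*(l+1) = 2*l+1+1 by ring, Nat.factorial_succ (2*l+1),
      Nat.factorial_succ (2*l), Nat.factorial_succ l]
    push_cast
    have : (Nat.factorial (2*l) : ℝ) ≠ 0 := by positivity
    field_simp
    ring

lemma legI_top (l : ℕ) : (2*l+1) * legI l l = 2 * Nat.factorial (2*l) := by
  unfold legI
  simp only [legQ_top]
  rw [intervalIntegral.integral_mul_const, integral_sin_pow_odd, prod_wallis]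
  have : (Nat.factorial (2*l) : ℝ) ≠ 0 := by positivity
  have : (Nat.factorial (l) : ℝ) ≠ 0 := by positivity
  field_simp

lemma legI_eq (n N : ℕ) : ∀ l, l = n + N →
    (2*(l:ℝ)+1) * (Nat.factorial N) * legI l n = 2 * Nat.factorial (l+n) := by
  induction N generalizing n with
  | zero =>
    intro l hl
    obtain rfl : l = n := by omega
    have := legI_top l
    rw [show l + l = 2*l by ring, ← this]; simp
  | succ N ih =>
    intro l hl
    have h := ih (n+1) l (by omega)
    rw [legI_succ, show l + (n+1) = l+n+1 by ring, Nat.factorial_succ] at h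
    rw [Nat.factorial_succ]
    have h1 : (l:ℝ) - n = N + 1 := by rw [hl]; push_cast; ring
    rw [h1] at h
    push_cast at h ⊢
    have h2 : ((l:ℝ)+n+1) ≠ 0 := by positivity
    apply mul_left_cancel₀ h2
    linear_combination h

lemma virial_alg (p S x s m κ R0 R1 R2 : ℝ) (h1 : S^2 + x^2 = 1)
   (ho : S^2 * R2 = 2*(m+2)*x*R1 - κ*R0) :
   (p * S * ((m+3/2)*x*R0 - S^2*R1)^2 + p * S * (((κ+(m+3/2)^2) * S^2 - (m+3/2)*(m+1/2)) * R0^2)) 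
   + s * ((2*m+1)*p*x * ((m+3/2)*x*R0 - S^2*R1)^2
     + p * S * (2 * ((m+3/2)*x*R0 - S^2*R1) * ((m+3/2)*(-S*R0 + x * (-(S*R1))) - (2*S*x*R1 + S^2 * (-(S*R2)))))
     + (2*m+1)*p*x * (((κ+(m+3/2)^2) * S^2 - (m+3/2)*(m+1/2)) * R0^2)
     + p * S * ((κ+(m+3/2)^2) * (2*S*x) * R0^2 + ((κ+(m+3/2)^2) * S^2 - (m+3/2)*(m+1/2)) * (2*R0*(-(S*R1)))))
   - ((2*m+2)*p*S*x * (R0 * ((m+3/2)*x*R0 - S^2*R1)) + p*S^2 * (-(S*R1)* ((m+3/2)*x*R0 - S^2*R1)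
      + R0 * ((m+3/2)*(-S*R0 + x * (-(S*R1))) - (2*S*x*R1 + S^2 * (-(S*R2))))))
   = 2 * ((m+3/2)*(m+1/2) * s * x * p * R0^2 - (m+3/2)*(m+1/2) * p * S * R0^2 + (κ+(m+3/2)^2) * p*S^3*R0^2) := by
  have hx : x^2 = 1 - S^2 := by linarith
  grind

/-- the virial integrand -/
noncomputable def virG (l m : ℕ) (s : ℝ) : ℝ :=
  ((m:ℝ)+3/2)*((m:ℝ)+1/2) * s * cos s * sin s ^ (2*m) * legQ l (m+1) (cos s) ^ 2
   - ((m:ℝ)+3/2)*((m:ℝ)+1/2) * sin s ^ (2*m) * sin s * legQ l (m+1) (cos s) ^ 2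
   + ((l:ℝ)+1/2)^2 * sin s ^ (2*m) * sin s ^ 3 * legQ l (m+1) (cos s) ^ 2

lemma virG_integral (l m : ℕ) : ∫ s in (0:ℝ)..π, virG l m s = 0 := by
  have hc0 := legQc_cont l (m+1)
  have key : ∫ s in (0:ℝ)..π, 2 * virG l m s = 0 := by
    rw [intervalIntegral.integral_eq_sub_of_hasDerivAt
      (f := fun s => s * (sin s ^ (2*m+1) * (((m:ℝ)+3/2) * (cos s * legQ l (m+1) (cos s))
          - sin s ^ 2 * legQ l (m+2) (cos s)) ^ 2
        + sin s ^ (2*m+1) * ((((l:ℝ)+1/2)^2 * sin s ^ 2 - ((m:ℝ)+3/2)*((m:ℝ)+1/2))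
            * legQ l (m+1) (cos s) ^ 2))
        - sin s ^ (2*m+2) * (legQ l (m+1) (cos s) * (((m:ℝ)+3/2) * (cos s * legQ l (m+1) (cos s))
          - sin s ^ 2 * legQ l (m+2) (cos s))))]
    · simp
    · intro s _
      have hS := hasDerivAt_sin s
      have hC := hasDerivAt_cos s
      have hR0 := legQc_hasDeriv l (m+1) s
      have hR1 := legQc_hasDeriv l (m+2) s
      have hT := ((hC.mul hR0).const_mul ((m:ℝ)+3/2)).sub ((hS.pow 2).mul hR1)
      have h := ((hasDerivAt_id s).mul (((hS.pow (2*m+1)).mul (hT.pow 2)).add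
        ((hS.pow (2*m+1)).mul ((((hS.pow 2).const_mul (((l:ℝ)+1/2)^2)).sub_const
          (((m:ℝ)+3/2)*((m:ℝ)+1/2))).mul (hR0.pow 2))))).sub
        ((hS.pow (2*m+2)).mul (hR0.mul hT))
      convert! h using 1
      have ho := legQ_ode l (m+1) (cos s)
      rw [← Real.sin_sq] at ho
      have ha := virial_alg (sin s ^ (2*m)) (sin s) (cos s) s m
        (((l:ℝ)+1/2)^2 - ((m:ℝ)+3/2)^2) (legQ l (m+1) (cos s)) (legQ l (m+2) (cos s))
        (legQ l (m+3) (cos s)) (Real.sin_sq_add_cos_sq s)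
        (by push_cast at ho; linear_combination ho)
      unfold virG
      simp
      rw [show m+2+1 = m+3 by ring, show m+1+1 = m+2 by ring]
      linear_combination -ha
    · apply Continuous.intervalIntegrable; unfold virG; fun_prop
  rw [intervalIntegral.integral_const_mul] at key
  linarith

lemma pageY_sq (l n : ℕ) (s : ℝ) (hs : 0 ≤ sin s) : pageY l n s ^ 2 =
    ((1 + 2 * (l : ℝ)) * (Nat.factorial (l - n) : ℝ) / (2 * (Nat.factorial (l + n) : ℝ))) *
      (sin s ^ (2*n+1) * legQ l n (cos s) ^ 2) := by
  unfold pageY assocLegendreP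
  rw [iteratedDeriv_legendreP, mul_pow, mul_pow, mul_pow, Real.sq_sqrt (by positivity),
    Real.sq_sqrt hs, ← Real.sin_sq, ← Real.rpow_natCast (_ ^ ((n:ℝ)/2)) 2,
    ← Real.rpow_mul (by positivity)]
  rw [show (n:ℝ)/2 * ((2:ℕ):ℝ) = (n:ℝ) by push_cast; ring, Real.rpow_natCast]
  ring

lemma integrand_eq (l m : ℕ) (ν μ s : ℝ) (hs : 0 < sin s) :
    deltaV (m+1) ν μ s * pageY l (m+1) s ^ 2 =
    ((1 + 2 * (l : ℝ)) * (Nat.factorial (l - (m+1)) : ℝ) / (2 * (Nat.factorial (l + (m+1)) : ℝ))) *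
    ν^2 * (virG l m s + ((16*μ+32*((m:ℝ)+1)^2+8)/32 - ((l:ℝ)+1/2)^2) *
        (sin s ^ (2*(m+1)+1) * legQ l (m+1) (cos s) ^ 2)
      - μ/4 * (sin s ^ 2 * (sin s ^ (2*(m+1)+1) * legQ l (m+1) (cos s) ^ 2))) := by
  rw [pageY_sq l (m+1) s hs.le]
  generalize ((1 + 2 * (l : ℝ)) * (Nat.factorial (l - (m+1)) : ℝ) / (2 * (Nat.factorial (l + (m+1)) : ℝ))) = K
  unfold deltaV virG
  have hC2 : cos s ^ 2 = 1 - sin s ^ 2 := Real.cos_sq' s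
  have h2 : cos (2*s) = 1 - 2 * sin s ^ 2 := by rw [Real.cos_two_mul, hC2]; ring
  have h4 : cos (4*s) = 1 - 8 * sin s ^ 2 + 8 * sin s ^ 4 := by
    rw [show 4*s = 2*(2*s) by ring, Real.cos_two_mul, h2]; ring
  rw [h2, h4]
  push_cast
  have hp : sin s ^ (2*(m+1)+1) = sin s ^ (2*m) * sin s ^ 3 := by ring
  rw [hp]
  generalize sin s ^ (2*m) = p
  generalize legQ l (m+1) (cos s) = R
  have := hs.ne'
  field_simp
  ring

/-- Large-overtone asymptotics of the first-order perturbative approximation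
`λ(N) = μ/4 + (n+N)(n+N+1) + ∫₀^π δV(s) y_{n+N,n}(s)² ds` to the spectrum of the Laplacian on
the Page metric: `λ(N) − (1−ν²)N(N+2n+1)` remains bounded as `N → ∞`. -/
theorem perturbative_eigenvalue_large_overtone (n k : ℕ) (hn : 1 ≤ n) (ν : ℝ)
    (μ : ℝ) (hμ : μ = (2 * (k : ℝ) + n) * (2 * (k : ℝ) + n + 2) - (n : ℝ) ^ 2) :
    ∃ C : ℝ, ∀ N : ℕ,
      |(μ / 4 + ((n : ℝ) + N) * ((n : ℝ) + N + 1) +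
          (∫ s in (0 : ℝ)..π, deltaV n ν μ s * (pageY (n + N) n s) ^ 2)) -
        (1 - ν ^ 2) * (N : ℝ) * ((N : ℝ) + 2 * (n : ℝ) + 1)| ≤ C := by
  obtain ⟨m, rfl⟩ : ∃ m, n = m + 1 := ⟨n - 1, by omega⟩
  refine ⟨|μ / 4| + ((m:ℝ)+1)*((m:ℝ)+2) + ν^2 * (|(16*μ+32*((m:ℝ)+1)^2+8)/32 - ((m:ℝ)+3/2)^2|
    + |μ/4|), fun N => ?_⟩
  set l := m + 1 + N with hl
  have hc0 := legQc_cont l (m+1)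
  set K : ℝ := ((1 + 2 * (l : ℝ)) * (Nat.factorial (l - (m+1)) : ℝ) /
    (2 * (Nat.factorial (l + (m+1)) : ℝ))) with hK
  have hK0 : 0 ≤ K := by positivity
  have hKI : K * legI l (m+1) = 1 := by
    have h := legI_eq (m+1) N l hl
    have hN : l - (m+1) = N := by omega
    have : (Nat.factorial (l + (m+1)) : ℝ) ≠ 0 := by positivity
    rw [hK, hN]
    field_simp
    linear_combination h
  set J : ℝ := ∫ s in (0:ℝ)..π, sin s ^ 2 * (sin s ^ (2*(m+1)+1) * legQ l (m+1) (cos s) ^ 2) with hJ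
  have hnn : ∀ s ∈ Icc (0:ℝ) π, 0 ≤ sin s ^ (2*(m+1)+1) * legQ l (m+1) (cos s) ^ 2 := by
    intro s hs
    have := Real.sin_nonneg_of_mem_Icc hs
    positivity
  have hJ0 : 0 ≤ J := by
    apply intervalIntegral.integral_nonneg Real.pi_pos.le
    intro s hs
    exact mul_nonneg (sq_nonneg _) (hnn s hs)
  have hJ1 : J ≤ legI l (m+1) := by
    apply intervalIntegral.integral_mono_on Real.pi_pos.le
    · apply Continuous.intervalIntegrable; fun_prop
    · apply Continuous.intervalIntegrable; fun_prop
    · intro s hs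
      exact mul_le_of_le_one_left (hnn s hs) (Real.sin_sq_le_one s)
  have hint : (∫ s in (0 : ℝ)..π, deltaV (m+1) ν μ s * (pageY l (m+1) s) ^ 2) =
      ν^2 * ((16*μ+32*((m:ℝ)+1)^2+8)/32 - ((l:ℝ)+1/2)^2 - μ/4 * (K * J)) := by
    have hv : Continuous (virG l m) := by unfold virG; fun_prop
    rw [intervalIntegral.integral_congr_Ioo_of_le Real.pi_pos.le (fun s hs =>
      integrand_eq l m ν μ s (Real.sin_pos_of_mem_Ioo hs)), intervalIntegral.integral_const_mul,
      intervalIntegral.integral_sub (by apply Continuous.intervalIntegrable; fun_prop)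
        (by apply Continuous.intervalIntegrable; fun_prop),
      intervalIntegral.integral_add (by apply Continuous.intervalIntegrable; fun_prop)
        (by apply Continuous.intervalIntegrable; fun_prop),
      intervalIntegral.integral_const_mul, intervalIntegral.integral_const_mul, virG_integral,
      ← hJ, ← hK]
    change K * ν^2 * (0 + _ * legI l (m+1) - _) = _
    linear_combination ν^2 * ((16*μ+32*((m:ℝ)+1)^2+8)/32 - ((l:ℝ)+1/2)^2) * hKI
  rw [hint]
  have ht0 : 0 ≤ K * J := mul_nonneg hK0 hJ0
  have ht1 : K * J ≤ 1 := by rw [← hKI]; exact mul_le_mul_of_nonneg_left hJ1 hK0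
  have hlr : (l:ℝ) = m + 1 + N := by rw [hl]; push_cast; ring
  have heq : (μ / 4 + (((m+1:ℕ) : ℝ) + N) * (((m+1:ℕ) : ℝ) + N + 1) +
      ν^2 * ((16*μ+32*((m:ℝ)+1)^2+8)/32 - ((l:ℝ)+1/2)^2 - μ/4 * (K * J))) -
        (1 - ν ^ 2) * (N : ℝ) * ((N : ℝ) + 2 * ((m+1:ℕ) : ℝ) + 1) =
      μ/4 + ((m:ℝ)+1)*((m:ℝ)+2) + ν^2 * (((16*μ+32*((m:ℝ)+1)^2+8)/32 - ((m:ℝ)+3/2)^2)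
        + -(μ/4 * (K*J))) := by
    rw [hlr]; push_cast; ring
  rw [heq]
  refine (abs_add_le _ _).trans (add_le_add ((abs_add_le _ _).trans (add_le_add le_rfl ?_)) ?_)
  · rw [abs_of_nonneg (by positivity)]
  · rw [abs_mul, abs_of_nonneg (sq_nonneg ν)]
    refine mul_le_mul_of_nonneg_left ((abs_add_le _ _).trans (add_le_add le_rfl ?_)) (sq_nonneg ν)
    rw [abs_neg, abs_mul, abs_of_nonneg ht0]
    exact mul_le_of_le_one_right (abs_nonneg _) ht1
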